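/- For every m ≥ 2 there is a constant c_m < ∞ depending only on m such that for all integers n_1 ≤ n_2 ≤ … ≤ n_m, the lamplighter space (La(G^m({n_i})), d_La) over the m-dimensional grid G^m({n_i}) = ⊕_{i=1}^m ([0,n_i]∩ℤ) with the ℓ1 metric admits a C-biLipschitz embedding into an ℓ1-product of 3m ℝ-trees, where C ≤ m·c_m·∏_{i=1}^{m-1} n_i. In particular, G^m({n_i}) is K-TSP-efficient with K ≤ c_m·∏_{i=1}^{m-1} n_i, a bound independent of the largest dimension n_m. -/

import Mathlib

open Metric Set
open scoped Classical ENNReal NNReal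

noncomputable section

/-- The underlying set of the lamplighter space over `X`: a lamp configuration
(a finite set of lit lamps) together with the position of the lamplighter. -/
abbrev Lamp (X : Type*) := Finset X × X

namespace Lamplighter

variable {X Y Z : Type*}

/-- The length of the path visiting the points of a list in order,
with respect to the distance function `d`. -/
def pathLength (d : X → X → ℝ) : List X → ℝ
  | [] => 0
  | [_] => 0
  | x :: y :: l => d x y + pathLength d (y :: l)

/-- The symmetric difference of the lamp configurations of `p` and `q`, as a set. -/
def sd (p q : Lamp X) : Set X :=
  ((p.1 : Set X) \ (q.1 : Set X)) ∪ ((q.1 : Set X) \ (p.1 : Set X))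

/-- The traveling salesman semimetric on the lamplighter space:
the infimum of lengths of finite paths starting at `p.2`, ending at `q.2`, and
visiting every point of the symmetric difference of the configurations. -/
def TSP (d : X → X → ℝ) (p q : Lamp X) : ℝ :=
  sInf { s : ℝ | ∃ l : List X, l.head? = some p.2 ∧ l.getLast? = some q.2 ∧
    (∀ a ∈ sd p q, a ∈ l) ∧ s = pathLength d l }

/-- The diameter (in `ℝ≥0∞`) of a set with respect to a distance function `d`. -/
def ediamD (d : X → X → ℝ) (A : Set X) : ℝ≥0∞ :=
  ⨆ x ∈ A, ⨆ y ∈ A, ENNReal.ofReal (d x y)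

/-- The traveling salesman shortcut semimetric:
`TSCP((A,x),(B,y)) = diam({x,y} ∪ (A Δ B))`. -/
def TSCP (d : X → X → ℝ) (p q : Lamp X) : ℝ :=
  (ediamD d ({p.2, q.2} ∪ sd p q)).toReal

/-- `ρ((A,x),(B,y))` is `0` if `A = B` and `1` otherwise. -/
def rho (p q : Lamp X) : ℝ := if p.1 = q.1 then 0 else 1

/-- The lamplighter metric `d_La = TSP + ρ`. -/
def dLa (d : X → X → ℝ) (p q : Lamp X) : ℝ := TSP d p q + rho p q

/-- `X` is `K`-TSP-efficient if `TSP ≤ K • TSCP` on `La(X)²`. -/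
def TSPEfficient (d : X → X → ℝ) (K : ℝ) : Prop :=
  ∀ p q : Lamp X, TSP d p q ≤ K * TSCP d p q

/-- A weak `C`-biLipschitz embedding between spaces with distance functions `dY`, `dZ`:
a family of maps `φ t : Y → Z` (for `t > 0`) such that each `φ t` is `σ t`-Lipschitz
and `dY x y ≥ C*t` implies `dZ (φ t x) (φ t y) ≥ t * σ t`. -/
def WeakBiLip (dY : Y → Y → ℝ) (dZ : Z → Z → ℝ) (C : ℝ) : Prop :=
  ∃ φ : ℝ → Y → Z, ∀ t : ℝ, 0 < t → ∃ σ : ℝ, 0 < σ ∧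
    (∀ x y : Y, dZ (φ t x) (φ t y) ≤ σ * dY x y) ∧
    (∀ x y : Y, C * t ≤ dY x y → t * σ ≤ dZ (φ t x) (φ t y))

/-- `f` is a `C`-biLipschitz embedding (an injective map of biLipschitz
distortion at most `C`, allowing an overall scaling factor `s`). -/
def BiLipWith (dY : Y → Y → ℝ) (dZ : Z → Z → ℝ) (C : ℝ) (f : Y → Z) : Prop :=
  Function.Injective f ∧ ∃ s : ℝ, 0 < s ∧
    ∀ x y : Y, s * dY x y ≤ dZ (f x) (f y) ∧ dZ (f x) (f y) ≤ C * s * dY x y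

/-- Nagata dimension at most `n` with constant at most `γ`: for every scale `s > 0`
there is a covering by sets of diameter at most `γ s` such that every set of diameter
less than `s` meets at most `n + 1` members of the covering. -/
def NagataDimD (d : Y → Y → ℝ) (n : ℕ) (γ : ℝ) : Prop :=
  ∀ s : ℝ, 0 < s → ∃ B : Set (Set Y),
    (∀ y : Y, ∃ b ∈ B, y ∈ b) ∧
    (∀ b ∈ B, ediamD d b ≤ ENNReal.ofReal (γ * s)) ∧
    (∀ A : Set Y, ediamD d A < ENNReal.ofReal s →
      {b | b ∈ B ∧ (b ∩ A).Nonempty}.encard ≤ ((n : ℕ∞) + 1))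

/-- Markov type 2 with constant `M`, for the distance function `d`: for every stationary
reversible Markov chain on a finite state space (given by a stationary distribution `μ`
and a reversible stochastic transition matrix `P`), every map `f` into the space, and
every time `t`, `E[d(f(Z_t),f(Z_0))²] ≤ M² t E[d(f(Z_1),f(Z_0))²]`. -/
def HasMarkovType2 (d : Y → Y → ℝ) (M : ℝ) : Prop :=
  ∀ (n : ℕ) (μ : Fin n → ℝ) (P : Matrix (Fin n) (Fin n) ℝ),
    (∀ i, 0 ≤ μ i) → (∑ i, μ i) = 1 →
    (∀ i j, 0 ≤ P i j) → (∀ i, (∑ j, P i j) = 1) →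
    (∀ i j, μ i * P i j = μ j * P j i) →
    ∀ (f : Fin n → Y) (t : ℕ),
      (∑ i, ∑ j, μ i * (P ^ t) i j * d (f i) (f j) ^ 2) ≤
        M ^ 2 * t * ∑ i, ∑ j, μ i * P i j * d (f i) (f j) ^ 2

/-- `D`-doubling: every ball of radius `r` can be covered by `D` balls of radius `r/2`. -/
def Doubling (d : Y → Y → ℝ) (D : ℕ) : Prop :=
  ∀ r : ℝ, 0 < r → ∀ x : Y, ∃ c : Fin D → Y,
    ∀ y : Y, d x y ≤ r → ∃ i, d (c i) y ≤ r / 2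

/-- `A` is an arc from `x` to `y`: the image of an injective continuous map of `[0,1]`
sending the endpoints to `x` and `y`. -/
def IsArc {T : Type*} [MetricSpace T] (x y : T) (A : Set T) : Prop :=
  ∃ γ : ℝ → T, ContinuousOn γ (Icc 0 1) ∧ InjOn γ (Icc 0 1) ∧
    γ 0 = x ∧ γ 1 = y ∧ γ '' (Icc 0 1) = A

/-- `A` is a geodesic segment from `x` to `y`: the image of an isometric embedding
of `[0, dist x y]` sending the endpoints to `x` and `y`. -/
def IsGeodesicSeg {T : Type*} [MetricSpace T] (x y : T) (A : Set T) : Prop :=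
  ∃ γ : ℝ → T, γ 0 = x ∧ γ (dist x y) = y ∧
    (∀ s ∈ Icc (0 : ℝ) (dist x y), ∀ t ∈ Icc (0 : ℝ) (dist x y),
      dist (γ s) (γ t) = |s - t|) ∧
    γ '' (Icc 0 (dist x y)) = A

/-- `T` is an ℝ-tree: any two (distinct) points are joined by a unique arc,
and this arc is a geodesic. -/
def IsRTree (T : Type*) [MetricSpace T] : Prop :=
  ∀ x y : T, x ≠ y →
    (∃ A : Set T, IsArc x y A) ∧
    (∀ A A' : Set T, IsArc x y A → IsArc x y A' → A = A') ∧
    (∀ A : Set T, IsArc x y A → IsGeodesicSeg x y A)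

/-- The sup (ℓ∞-product) distance on a finite product of metric spaces. -/
def piSupDist {n : ℕ} {T : Fin n → Type*} (I : ∀ i, MetricSpace (T i)) :
    (∀ i, T i) → (∀ i, T i) → ℝ :=
  letI := I
  fun f g => dist f g

/-- The ℓ1-product distance on a finite product of metric spaces. -/
def piL1Dist {n : ℕ} {T : Fin n → Type*} (I : ∀ i, MetricSpace (T i)) :
    (∀ i, T i) → (∀ i, T i) → ℝ :=
  letI := I
  fun f g => ∑ i, dist (f i) (g i)

/-- The ℓ1 distance on `ℝ^m`. -/
def l1Dist (m : ℕ) (x y : Fin m → ℝ) : ℝ := ∑ i, |x i - y i|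

/-- The ℓp distance on `ℝ^m`. -/
def lpDist (m : ℕ) (p : ℝ) (x y : Fin m → ℝ) : ℝ :=
  (∑ i, |x i - y i| ^ p) ^ (1 / p)

/-- The (pseudo)distance of the ℝ-star over the index type `ι`: the wedge sum of
copies of `[0,∞)` indexed by `ι`, glued at `0`. -/
def starDist {ι : Type*} (p q : ι × ℝ≥0) : ℝ :=
  if p.1 = q.1 then |(p.2 : ℝ) - (q.2 : ℝ)| else (p.2 : ℝ) + (q.2 : ℝ)

/-- The sup (ℓ∞-product) of finitely many distance functions. -/
def supD {n : ℕ} {T : Fin n → Type*} (d : ∀ i, T i → T i → ℝ) (f g : ∀ i, T i) : ℝ :=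
  ((Finset.univ.sup fun i => (d i (f i) (g i)).toNNReal : ℝ≥0) : ℝ)

/-- The infimum of distortions of biLipschitz embeddings of `(Y, dY)` into `(Z, dZ)`
(`∞` if there is no such embedding). -/
def cEmb (dY : Y → Y → ℝ) (dZ : Z → Z → ℝ) : ℝ≥0∞ :=
  sInf { D : ℝ≥0∞ | ∃ C : ℝ, 0 < C ∧ D = ENNReal.ofReal C ∧
    ∃ f : Y → Z, BiLipWith dY dZ C f }

/-- `c_1^{m,dom}(X,d)`: the infimum of all `D > 0` such that there exist injective
`1`-Lipschitz maps `φ i : X → ℝ` and weights `α i ≥ 0` summing to `1` with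
`∑ i, α i * |φ i x - φ i y| ≥ d x y / D` for all `x y` (`∞` if there is none). -/
def c1dom (d : X → X → ℝ) (m : ℕ) : ℝ≥0∞ :=
  sInf { D : ℝ≥0∞ | ∃ C : ℝ, 0 < C ∧ D = ENNReal.ofReal C ∧
    ∃ (φ : Fin m → X → ℝ) (α : Fin m → ℝ),
      (∀ i, Function.Injective (φ i)) ∧
      (∀ i, ∀ x y : X, |φ i x - φ i y| ≤ d x y) ∧
      (∀ i, 0 ≤ α i) ∧ (∑ i, α i) = 1 ∧
      ∀ x y : X, d x y / C ≤ ∑ i, α i * |φ i x - φ i y| }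

/-- The Hamming distance on the Hamming cube `{0,1}^M`, as a real number. -/
def hamDist {M : ℕ} (x y : Fin M → Bool) : ℝ :=
  ((Finset.univ.filter fun i => x i ≠ y i).card : ℝ)

/-- The star graph `St_{n,k}`: the one-point coalescence of `n` paths of length `k`,
realized inside `ℤ^n` as the multiples `α eᵢ` with `0 ≤ α ≤ k`. -/
def St (n k : ℕ) : Type :=
  {x : Fin n → ℤ // ∃ i : Fin n, (∀ j : Fin n, j ≠ i → x j = 0) ∧ 0 ≤ x i ∧ x i ≤ (k : ℤ)}

/-- The ℓ1 metric on the star graph `St_{n,k}`. -/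
def stDist {n k : ℕ} (x y : St n k) : ℝ := ∑ j, |(x.1 j : ℝ) - (y.1 j : ℝ)|

/-- The endpoint `k eᵢ` of the `i`-th branch of the star graph. -/
def St.endpoint {n k : ℕ} (i : Fin n) : St n k :=
  ⟨fun j => if j = i then (k : ℤ) else 0, i, fun j hj => if_neg hj, by simp, by simp⟩

/-- The cycle metric on `ℤ/nℤ`. -/
def cycDist {n : ℕ} (a b : ZMod n) : ℝ := ((min ((a - b).val) ((b - a).val) : ℕ) : ℝ)

/-- The rectangular grid `G_{k,n} = ([0,k] ∩ ℤ) × ([0,n] ∩ ℤ)`. -/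
def Grid2 (k n : ℕ) : Type :=
  {p : ℤ × ℤ // 0 ≤ p.1 ∧ p.1 ≤ (k : ℤ) ∧ 0 ≤ p.2 ∧ p.2 ≤ (n : ℤ)}

/-- The ℓ1 metric on the grid `G_{k,n}`. -/
def grid2Dist {k n : ℕ} (x y : Grid2 k n) : ℝ :=
  |(x.1.1 : ℝ) - (y.1.1 : ℝ)| + |(x.1.2 : ℝ) - (y.1.2 : ℝ)|

/-- The `m`-dimensional grid `G^m({n_i}) = ∏ i, ([0, n_i] ∩ ℤ)`. -/
def GridM (m : ℕ) (n : Fin m → ℕ) : Type :=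
  {p : Fin m → ℤ // ∀ i, 0 ≤ p i ∧ p i ≤ (n i : ℤ)}

/-- The ℓ1 metric on the `m`-dimensional grid. -/
def gridMDist {m : ℕ} {n : Fin m → ℕ} (x y : GridM m n) : ℝ :=
  ∑ i, |(x.1 i : ℝ) - (y.1 i : ℝ)|

section RTree

variable {T : Type*} [MetricSpace T]

/-- In a space satisfying the four-point condition, a connected set containing `x` and `y`
contains every point metrically between `x` and `y`. -/
theorem mem_of_isPreconnected_of_between
    (h4 : ∀ x y z w : T,
      dist x y + dist z w ≤ max (dist x z + dist y w) (dist x w + dist y z))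
    {C : Set T} (hC : IsPreconnected C) {x y z : T} (hx : x ∈ C) (hy : y ∈ C)
    (hz : dist x z + dist z y = dist x y) : z ∈ C := by
  by_contra hzC
  have hxz : x ≠ z := fun h => hzC (h ▸ hx)
  have hyz : y ≠ z := fun h => hzC (h ▸ hy)
  set π : T → ℝ := fun w => dist w x - dist w y with hπ
  have hcont : Continuous π := by fun_prop
  have hE : IsOpen {w : T | π w = π z ∧ w ≠ z} := by
    rw [Metric.isOpen_iff]
    rintro w ⟨hw, hwz⟩
    refine ⟨dist w z, dist_pos.2 hwz, fun v hv => ?_⟩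
    rw [Metric.mem_ball] at hv
    simp only [hπ] at hw
    have hvz : v ≠ z := by
      rintro rfl
      rw [dist_comm] at hv
      exact lt_irrefl _ hv
    refine ⟨?_, hvz⟩
    have hcomm := fun a b : T => dist_comm a b
    have e1 := h4 x w z y
    have e2 := h4 x y z w
    have t1 := dist_triangle w z x
    have t2 := dist_triangle w z y
    have hwx : dist w x = dist w z + dist z x := by
      rw [hcomm w y, hcomm z y] at hw
      rw [hcomm x z, hcomm x w, hcomm y w] at e2
      rw [hcomm x z] at hz
      rcases le_max_iff.1 e2 with h | h <;>
        linarith [hcomm w y, hcomm z y, hcomm z w, hcomm z x]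
    have hwy : dist w y = dist w z + dist z y := by linarith
    have key : ∀ a : T, dist w a = dist w z + dist z a → dist v a = dist v z + dist z a := by
      intro a ha
      have f := h4 a w z v
      have t3 := dist_triangle v z a
      have t4 : 0 < dist v z := dist_pos.2 hvz
      rw [hcomm a w, hcomm z v, hcomm a z, hcomm w v, hcomm a v] at f
      rcases le_max_iff.1 f with h | h <;> linarith
    simp only [hπ]
    linarith [key x hwx, key y hwy]
  have hU : IsOpen ({w : T | π w < π z} ∪ {w : T | π w = π z ∧ w ≠ z}) :=
    (isOpen_lt hcont continuous_const).union hE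
  have hV : IsOpen {w : T | π z < π w} := isOpen_lt continuous_const hcont
  have hxU : π x ≤ π z := by
    simp only [hπ, dist_self]
    linarith [dist_triangle x z y, dist_comm x z, dist_nonneg (x := x) (y := z)]
  have hyV : π z < π y := by
    simp only [hπ, dist_self]
    linarith [dist_pos.2 hyz, dist_comm y z, dist_comm y x, dist_comm x z]
  obtain ⟨w, -, hwU, hwV⟩ := hC _ _ hU hV (fun w hw => by
      rcases lt_trichotomy (π w) (π z) with h | h | h
      · exact Or.inl (Or.inl h)
      · exact Or.inl (Or.inr ⟨h, fun e => hzC (e ▸ hw)⟩)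
      · exact Or.inr h)
    ⟨x, hx, hxU.lt_or_eq.imp id fun h => ⟨h, hxz⟩⟩ ⟨y, hy, hyV⟩
  rcases hwU with h | h
  · exact lt_asymm (show π w < π z from h) hwV
  · exact (ne_of_gt hwV) h.1

/-- In a space satisfying the four-point condition, every arc is the geodesic segment
with the same endpoints. -/
theorem IsArc.eq_of_isGeodesicSeg
    (h4 : ∀ x y z w : T,
      dist x y + dist z w ≤ max (dist x z + dist y w) (dist x w + dist y z))
    {x y : T} {A G : Set T} (hA : IsArc x y A) (hG : IsGeodesicSeg x y G) : A = G := by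
  obtain ⟨α, hαc, hαi, rfl, rfl, rfl⟩ := hA
  obtain ⟨γ, hγ0, hγ1, hγ, rfl⟩ := hG
  have h0 : (0 : ℝ) ∈ Icc (0 : ℝ) 1 := by simp
  have h1 : (1 : ℝ) ∈ Icc (0 : ℝ) 1 := by simp
  have hL : (0 : ℝ) ≤ dist (α 0) (α 1) := dist_nonneg
  have m0 : (0 : ℝ) ∈ Icc 0 (dist (α 0) (α 1)) := ⟨le_rfl, hL⟩
  have m1 : dist (α 0) (α 1) ∈ Icc 0 (dist (α 0) (α 1)) := ⟨hL, le_rfl⟩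
  have hγc : ContinuousOn γ (Icc 0 (dist (α 0) (α 1))) := by
    refine (LipschitzOnWith.of_dist_le_mul (K := 1) fun s hs t ht => ?_).continuousOn
    rw [hγ s hs t ht, Real.dist_eq]
    simp
  apply Subset.antisymm
  · rintro _ ⟨t, ht, rfl⟩
    have hsub : γ '' Icc 0 (dist (α 0) (α 1)) ⊆ α '' Icc 0 t ∪ α '' Icc t 1 := by
      rw [← image_union, Icc_union_Icc_eq_Icc ht.1 ht.2]
      rintro _ ⟨r, hr, rfl⟩
      refine mem_of_isPreconnected_of_between h4 (isPreconnected_Icc.image α hαc)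
        (mem_image_of_mem α h0) (mem_image_of_mem α h1) ?_
      have e1 := hγ 0 m0 r hr
      have e2 := hγ r hr _ m1
      rw [hγ0] at e1
      rw [hγ1] at e2
      rw [e1, e2, abs_of_nonpos (by linarith [hr.1]), abs_of_nonpos (by linarith [hr.2])]
      ring
    have hs1 : Icc 0 t ⊆ Icc (0 : ℝ) 1 := Icc_subset_Icc_right ht.2
    have hs2 : Icc t 1 ⊆ Icc (0 : ℝ) 1 := Icc_subset_Icc_left ht.1
    obtain ⟨w, hwG, ⟨a, ha, rfl⟩, b, hb, hab⟩ :=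
      isPreconnected_closed_iff.1 (isPreconnected_Icc.image γ hγc) _ _
        (isCompact_Icc.image_of_continuousOn (hαc.mono hs1)).isClosed
        (isCompact_Icc.image_of_continuousOn (hαc.mono hs2)).isClosed hsub
        ⟨α 0, ⟨0, m0, hγ0⟩, mem_image_of_mem α ⟨le_rfl, ht.1⟩⟩
        ⟨α 1, ⟨_, m1, hγ1⟩, mem_image_of_mem α ⟨ht.2, le_rfl⟩⟩
    have : b = a := hαi (hs2 hb) (hs1 ha) hab
    have hat : a = t := le_antisymm ha.2 (this ▸ hb.1)
    exact hat ▸ hwG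
  · rintro _ ⟨r, hr, rfl⟩
    refine mem_of_isPreconnected_of_between h4 (isPreconnected_Icc.image α hαc)
      (mem_image_of_mem α h0) (mem_image_of_mem α h1) ?_
    have e1 := hγ 0 m0 r hr
    have e2 := hγ r hr _ m1
    rw [hγ0] at e1
    rw [hγ1] at e2
    rw [e1, e2, abs_of_nonpos (by linarith [hr.1]), abs_of_nonpos (by linarith [hr.2])]
    ring

theorem IsGeodesicSeg.isArc {x y : T} {G : Set T} (hG : IsGeodesicSeg x y G) (hxy : x ≠ y) :
    IsArc x y G := by
  obtain ⟨γ, hγ0, hγ1, hγ, rfl⟩ := hG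
  have hL : 0 < dist x y := dist_pos.2 hxy
  have hm : ∀ t ∈ Icc (0 : ℝ) 1, dist x y * t ∈ Icc 0 (dist x y) := fun t ht =>
    ⟨mul_nonneg hL.le ht.1, mul_le_of_le_one_right hL.le ht.2⟩
  have hd : ∀ s ∈ Icc (0 : ℝ) 1, ∀ t ∈ Icc (0 : ℝ) 1,
      dist (γ (dist x y * s)) (γ (dist x y * t)) = dist x y * |s - t| := by
    intro s hs t ht
    rw [hγ _ (hm s hs) _ (hm t ht), ← mul_sub, abs_mul, abs_of_pos hL]
  refine ⟨fun t => γ (dist x y * t), ?_, ?_, by simpa using hγ0, by simpa using hγ1, ?_⟩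
  · refine (LipschitzOnWith.of_dist_le_mul (K := ⟨dist x y, hL.le⟩)
      fun s hs t ht => ?_).continuousOn
    rw [hd s hs t ht, Real.dist_eq]
    rfl
  · intro s hs t ht hst
    have h := hd s hs t ht
    simp only at hst
    rw [hst, dist_self] at h
    have h' : |s - t| = 0 := by
      rcases mul_eq_zero.1 h.symm with h | h
      · exact absurd h hL.ne'
      · exact h
    exact sub_eq_zero.1 (abs_eq_zero.1 h')
  · ext z
    constructor
    · rintro ⟨t, ht, rfl⟩
      exact ⟨_, hm t ht, rfl⟩
    · rintro ⟨r, hr, rfl⟩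
      refine ⟨r / dist x y, ⟨div_nonneg hr.1 hL.le, (div_le_one hL).2 hr.2⟩, ?_⟩
      simp only
      rw [mul_div_cancel₀ _ hL.ne']

/-- A geodesic metric space satisfying the four-point condition is an ℝ-tree. -/
theorem isRTree_of_fourPoint
    (h4 : ∀ x y z w : T,
      dist x y + dist z w ≤ max (dist x z + dist y w) (dist x w + dist y z))
    (hg : ∀ x y : T, ∃ G : Set T, IsGeodesicSeg x y G) : IsRTree T := by
  intro x y hxy
  obtain ⟨G, hG⟩ := hg x y
  have h : ∀ A, IsArc x y A → A = G := fun A hA => hA.eq_of_isGeodesicSeg h4 hG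
  exact ⟨⟨G, hG.isArc hxy⟩, fun A A' hA hA' => (h A hA).trans (h A' hA').symm,
    fun A hA => (h A hA).symm ▸ hG⟩

end RTree

section LampTree

/-- A lamp configuration together with a height. Two configurations are identified above the
heights (measured by `f`) of the lamps at which they differ. -/
structure LampHeight (f : X → ℝ≥0) where
  /-- The lamp configuration. -/
  lamps : Finset X
  /-- The height. -/
  height : ℝ≥0

/-- The height at which the branches of two points of `LampHeight f` merge. -/
def LampHeight.merge {f : X → ℝ≥0} (a b : LampHeight f) : ℝ≥0 :=
  max (max a.height b.height) ((symmDiff a.lamps b.lamps).sup f)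

variable {f : X → ℝ≥0}

namespace LampHeight

theorem height_le_merge (a b : LampHeight f) : a.height ≤ a.merge b :=
  (le_max_left _ _).trans (le_max_left _ _)

theorem merge_comm (a b : LampHeight f) : a.merge b = b.merge a := by
  rw [merge, merge, max_comm a.height, symmDiff_comm]

theorem merge_self (a : LampHeight f) : a.merge a = a.height := by
  simp [merge]

theorem merge_le_max (a b c : LampHeight f) : a.merge c ≤ max (a.merge b) (b.merge c) := by
  have h1 : a.height ≤ max (a.merge b) (b.merge c) :=
    (height_le_merge a b).trans (le_max_left _ _)
  have h2 : c.height ≤ max (a.merge b) (b.merge c) :=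
    (merge_comm b c ▸ height_le_merge c b).trans (le_max_right _ _)
  refine max_le (max_le h1 h2) ?_
  refine (Finset.sup_mono (symmDiff_triangle a.lamps b.lamps c.lamps)).trans ?_
  rw [Finset.sup_eq_union, Finset.sup_union]
  exact max_le_max (le_max_right _ _) (le_max_right _ _)

instance : PseudoMetricSpace (LampHeight f) where
  dist a b := 2 * (a.merge b : ℝ) - a.height - b.height
  dist_self a := by rw [merge_self]; ring
  dist_comm a b := by rw [merge_comm]; ring
  dist_triangle a b c := by
    have h : (a.merge c : ℝ) ≤ max (a.merge b : ℝ) (b.merge c : ℝ) := by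
      exact_mod_cast merge_le_max a b c
    have h1 : (b.height : ℝ) ≤ a.merge b := by
      rw [merge_comm]; exact_mod_cast height_le_merge b a
    have h2 : (b.height : ℝ) ≤ b.merge c := by exact_mod_cast height_le_merge b c
    rcases le_max_iff.1 h with h | h <;> linarith

theorem dist_def (a b : LampHeight f) :
    dist a b = 2 * (a.merge b : ℝ) - a.height - b.height := rfl

theorem dist_mk (A B : Finset X) (u v : ℝ≥0) :
    dist (⟨A, u⟩ : LampHeight f) ⟨B, v⟩ =
      2 * max (max (u : ℝ) v) ((symmDiff A B).sup f : ℝ≥0) - u - v := by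
  simp [dist_def, merge]

theorem fourPoint (x y z w : LampHeight f) :
    dist x y + dist z w ≤ max (dist x z + dist y w) (dist x w + dist y z) := by
  have h1 : (x.merge y : ℝ) ≤ max (x.merge z : ℝ) (y.merge z : ℝ) := by
    rw [merge_comm y z]; exact_mod_cast merge_le_max x z y
  have h2 : (x.merge y : ℝ) ≤ max (x.merge w : ℝ) (y.merge w : ℝ) := by
    rw [merge_comm y w]; exact_mod_cast merge_le_max x w y
  have h3 : (z.merge w : ℝ) ≤ max (x.merge z : ℝ) (x.merge w : ℝ) := by
    rw [merge_comm x z]; exact_mod_cast merge_le_max z x w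
  have h4 : (z.merge w : ℝ) ≤ max (y.merge z : ℝ) (y.merge w : ℝ) := by
    rw [merge_comm y z]; exact_mod_cast merge_le_max z y w
  simp only [dist_def]
  by_contra! hcon
  obtain ⟨c1, c2⟩ := max_lt_iff.1 hcon
  rcases le_max_iff.1 h1 with h1 | h1 <;> rcases le_max_iff.1 h2 with h2 | h2 <;>
    rcases le_max_iff.1 h3 with h3 | h3 <;> rcases le_max_iff.1 h4 with h4 | h4 <;> linarith

end LampHeight

variable (f) in
/-- The tree of lamp configurations with heights. -/
abbrev LampTree : Type _ := SeparationQuotient (LampHeight f)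

theorem LampTree.exists_isGeodesicSeg (x y : LampTree f) :
    ∃ G : Set (LampTree f), IsGeodesicSeg x y G := by
  obtain ⟨a, rfl⟩ := SeparationQuotient.surjective_mk x
  obtain ⟨b, rfl⟩ := SeparationQuotient.surjective_mk y
  obtain ⟨M, hM⟩ : ∃ M : ℝ, M = (a.merge b : ℝ≥0) := ⟨_, rfl⟩
  have ha : (a.height : ℝ) ≤ M := by rw [hM]; exact_mod_cast LampHeight.height_le_merge a b
  have hb : (b.height : ℝ) ≤ M := by
    rw [hM, LampHeight.merge_comm]; exact_mod_cast LampHeight.height_le_merge b a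
  have ha0 : (0 : ℝ) ≤ a.height := a.height.2
  have hb0 : (0 : ℝ) ≤ b.height := b.height.2
  obtain ⟨S, hS⟩ : ∃ S : ℝ, S = ((symmDiff a.lamps b.lamps).sup f : ℝ≥0) := ⟨_, rfl⟩
  have hMS : M = max (max (a.height : ℝ) b.height) S := by
    simp [hM, hS, LampHeight.merge]
  have hSM : S ≤ M := hMS ▸ le_max_right _ _
  have hD : dist a b = 2 * M - a.height - b.height := by rw [hM]; rfl
  set γ : ℝ → LampHeight f := fun r =>
    if a.height + r ≤ M then ⟨a.lamps, (a.height + r).toNNReal⟩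
    else ⟨b.lamps, (2 * M - a.height - r).toNNReal⟩ with hγ
  have hiso : ∀ r ∈ Icc (0 : ℝ) (dist a b), ∀ r' ∈ Icc (0 : ℝ) (dist a b), r ≤ r' →
      dist (γ r) (γ r') = r' - r := by
    intro r hr r' hr' hrr
    rw [hD] at hr hr'
    obtain ⟨hr0, hr1⟩ := hr
    obtain ⟨hr0', hr1'⟩ := hr'
    by_cases h : a.height + r ≤ M <;> by_cases h' : a.height + r' ≤ M
    · simp only [hγ, if_pos h, if_pos h', LampHeight.dist_mk, symmDiff_self]
      rw [Real.coe_toNNReal _ (by linarith), Real.coe_toNNReal _ (by linarith),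
        max_eq_right (a := (a.height : ℝ) + r) (by linarith)]
      simp only [Finset.bot_eq_empty, Finset.sup_empty, bot_eq_zero', NNReal.coe_zero]
      rw [max_eq_left (by linarith)]
      ring
    · simp only [hγ, if_pos h, if_neg h', LampHeight.dist_mk]
      rw [Real.coe_toNNReal _ (by linarith), Real.coe_toNNReal _ (by linarith), ← hS]
      have : max (max (a.height + r) (2 * M - a.height - r')) S = M := by
        refine le_antisymm (max_le (max_le h (by linarith)) hSM) ?_
        rcases le_max_iff.1 hMS.le with h1 | h1
        · rcases le_max_iff.1 h1 with h1 | h1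
          · exact le_max_of_le_left (le_max_of_le_left (by linarith))
          · exact le_max_of_le_left (le_max_of_le_right (by linarith))
        · exact le_max_of_le_right h1
      rw [this]
      ring
    · exact absurd (by linarith) h
    · simp only [hγ, if_neg h, if_neg h', LampHeight.dist_mk, symmDiff_self]
      rw [Real.coe_toNNReal _ (by linarith), Real.coe_toNNReal _ (by linarith),
        max_eq_left (a := 2 * M - (a.height : ℝ) - r) (by linarith)]
      simp only [Finset.bot_eq_empty, Finset.sup_empty, bot_eq_zero', NNReal.coe_zero]
      rw [max_eq_left (by linarith)]
      ring
  refine ⟨_, fun r => SeparationQuotient.mk (γ r), ?_, ?_, ?_, rfl⟩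
  · simp [hγ, ha]
  · rw [SeparationQuotient.dist_mk, SeparationQuotient.mk_eq_mk, Metric.inseparable_iff]
    by_cases h : a.height + dist a b ≤ M
    · have hbM : (b.height : ℝ) = M := by linarith
      have hh : a.height + dist a b = b.height := by rw [hD]; linarith
      simp only [hγ, if_pos h, hh, Real.toNNReal_coe]
      refine (LampHeight.dist_mk a.lamps b.lamps b.height b.height).trans ?_
      rw [max_self, ← hS, max_eq_left (hbM ▸ hSM)]
      ring
    · have hh : 2 * M - a.height - dist a b = b.height := by rw [hD]; ring
      simp only [hγ, if_neg h, hh, Real.toNNReal_coe]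
      exact dist_self b
  · intro r hr r' hr'
    rw [SeparationQuotient.dist_mk] at hr hr' ⊢
    rcases le_total r r' with h | h
    · rw [hiso r hr r' hr' h, abs_of_nonpos (by linarith)]
      ring
    · rw [dist_comm, hiso r' hr' r hr h, abs_of_nonneg (by linarith)]

theorem LampTree.isRTree : IsRTree (LampTree f) := by
  refine isRTree_of_fourPoint (fun x y z w => ?_) LampTree.exists_isGeodesicSeg
  obtain ⟨x, rfl⟩ := SeparationQuotient.surjective_mk x
  obtain ⟨y, rfl⟩ := SeparationQuotient.surjective_mk y
  obtain ⟨z, rfl⟩ := SeparationQuotient.surjective_mk z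
  obtain ⟨w, rfl⟩ := SeparationQuotient.surjective_mk w
  simp only [SeparationQuotient.dist_mk]
  exact LampHeight.fourPoint _ _ _ _

end LampTree

section Tours

variable {d : X → X → ℝ}

theorem pathLength_nonneg (h0 : ∀ a b, 0 ≤ d a b) : ∀ l : List X, 0 ≤ pathLength d l
  | [] => le_rfl
  | [_] => le_rfl
  | x :: y :: l => add_nonneg (h0 x y) (pathLength_nonneg h0 (y :: l))

theorem dist_head_le_pathLength (h0 : ∀ a b, 0 ≤ d a b) (hself : ∀ a, d a a = 0)
    (htri : ∀ a b c, d a c ≤ d a b + d b c) {v : X} :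
    ∀ (x : X) (l : List X), v ∈ x :: l → d x v ≤ pathLength d (x :: l)
  | x, [], hv => by
    obtain rfl : v = x := by simpa using hv
    exact (hself v).le
  | x, y :: l, hv => by
    rcases List.mem_cons.1 hv with rfl | hv
    · rw [hself]
      exact pathLength_nonneg h0 _
    · have := dist_head_le_pathLength h0 hself htri y l hv
      exact (htri x y v).trans (add_le_add le_rfl this)

theorem dist_le_pathLength (h0 : ∀ a b, 0 ≤ d a b) (hself : ∀ a, d a a = 0)
    (hcomm : ∀ a b, d a b = d b a) (htri : ∀ a b c, d a c ≤ d a b + d b c) {u v : X} :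
    ∀ l : List X, u ∈ l → v ∈ l → d u v ≤ pathLength d l
  | [], hu, _ => by simp at hu
  | x :: l, hu, hv => by
    rcases List.mem_cons.1 hu with rfl | hu'
    · exact dist_head_le_pathLength h0 hself htri _ _ hv
    rcases List.mem_cons.1 hv with rfl | hv'
    · rw [hcomm]
      exact dist_head_le_pathLength h0 hself htri _ _ hu
    refine (dist_le_pathLength h0 hself hcomm htri l hu' hv').trans ?_
    cases l with
    | nil => simp at hu'
    | cons y l => exact le_add_of_nonneg_left (h0 x y)

theorem pathLength_append_cons (s : X) (l₂ : List X) :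
    ∀ l₁ : List X, pathLength d (l₁ ++ s :: l₂) =
      pathLength d (l₁ ++ [s]) + pathLength d (s :: l₂)
  | [] => by simp [pathLength]
  | [x] => by simp [pathLength]
  | x :: y :: l => by
    have := pathLength_append_cons s l₂ (y :: l)
    simp only [List.cons_append, pathLength] at this ⊢
    rw [this, add_assoc]

/-- A closed tour can be extended by one point next to a point already visited,
at the cost of going there and back. -/
theorem exists_tour_insert (hcomm : ∀ a b, d a b = d b a) {x s a : X} {l : List X}
    (hs : s ∈ l) (hh : l.head? = some x) (hl : l.getLast? = some x) :
    ∃ l' : List X, l'.head? = some x ∧ l'.getLast? = some x ∧ l ⊆ l' ∧ a ∈ l' ∧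
      pathLength d l' = pathLength d l + 2 * d s a := by
  obtain ⟨l₁, l₂, rfl⟩ := List.append_of_mem hs
  refine ⟨l₁ ++ s :: a :: s :: l₂, ?_, ?_, ?_, ?_, ?_⟩
  · cases l₁ <;> simpa using hh
  · simpa [List.getLast?_append, List.getLast?_cons_cons] using hl
  · intro z hz
    simp only [List.mem_append, List.mem_cons] at hz ⊢
    tauto
  · simp
  · rw [pathLength_append_cons, pathLength_append_cons s l₂]
    simp only [pathLength]
    rw [hcomm a s]
    ring

/-- A finite set that is connected through unit steps has a closed tour of length at most
twice the number of its points. -/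
theorem exists_tour (hcomm : ∀ a b, d a b = d b a) (x : X) (rank : X → ℕ) (B : Finset X) :
    (∀ v ∈ B, ∃ s ∈ insert x B, d s v ≤ 1 ∧ rank s < rank v) →
    ∃ l : List X, l.head? = some x ∧ l.getLast? = some x ∧ (∀ v ∈ insert x B, v ∈ l) ∧
      pathLength d l ≤ 2 * B.card := by
  induction B using Finset.induction_on_max_value rank with
  | empty => exact fun _ => ⟨[x], by simp [pathLength]⟩
  | insert a B ha hmax ih =>
    intro hB
    have key : ∀ v ∈ insert a B, ∃ s ∈ insert x B, d s v ≤ 1 ∧ rank s < rank v := by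
      intro v hv
      obtain ⟨s, hs, h1, h2⟩ := hB v hv
      refine ⟨s, ?_, h1, h2⟩
      have hva : rank v ≤ rank a := by
        rcases Finset.mem_insert.1 hv with rfl | hv
        · exact le_rfl
        · exact hmax v hv
      have : s ≠ a := by
        rintro rfl
        omega
      simp only [Finset.mem_insert] at hs ⊢
      tauto
    obtain ⟨l, hh, hl, hmem, hlen⟩ := ih fun v hv => key v (Finset.mem_insert_of_mem hv)
    obtain ⟨s, hs, h1, -⟩ := key a (Finset.mem_insert_self _ _)
    obtain ⟨l', hh', hl', hsub, hal, hlen'⟩ :=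
      exists_tour_insert (a := a) hcomm (hmem s hs) hh hl
    refine ⟨l', hh', hl', ?_, ?_⟩
    · intro v hv
      by_cases hva : v = a
      · exact hva ▸ hal
      · refine hsub (hmem v ?_)
        simp only [Finset.mem_insert] at hv ⊢
        tauto
    · rw [hlen', Finset.card_insert_of_notMem ha]
      push_cast
      linarith

theorem bddBelow_pathLength (h0 : ∀ a b, 0 ≤ d a b) (p q : Lamp X) :
    BddBelow { s : ℝ | ∃ l : List X, l.head? = some p.2 ∧ l.getLast? = some q.2 ∧
      (∀ a ∈ sd p q, a ∈ l) ∧ s = pathLength d l } := by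
  refine ⟨0, ?_⟩
  rintro _ ⟨l, -, -, -, rfl⟩
  exact pathLength_nonneg h0 l

theorem TSP_le_pathLength (h0 : ∀ a b, 0 ≤ d a b) {p q : Lamp X} {l : List X}
    (hh : l.head? = some p.2) (hl : l.getLast? = some q.2) (hm : ∀ a ∈ sd p q, a ∈ l) :
    TSP d p q ≤ pathLength d l :=
  csInf_le (bddBelow_pathLength h0 p q) ⟨l, hh, hl, hm, rfl⟩

theorem sd_eq_coe_symmDiff (p q : Lamp X) : sd p q = (symmDiff p.1 q.1 : Finset X) := by
  rw [Finset.coe_symmDiff]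
  rfl

theorem TSP_le_pathLength_add (h0 : ∀ a b, 0 ≤ d a b) {p q : Lamp X} {l : List X}
    (hh : l.head? = some p.2) (hl : l.getLast? = some p.2) (hm : ∀ a ∈ sd p q, a ∈ l) :
    TSP d p q ≤ pathLength d l + d p.2 q.2 := by
  obtain ⟨l₀, rfl⟩ := List.getLast?_eq_some_iff.1 hl
  have h := TSP_le_pathLength (d := d) (p := p) (q := q) (l := l₀ ++ p.2 :: [q.2]) h0
    (by cases l₀ <;> simp_all) (by simp [List.getLast?_append])
    (fun a ha => by
      have := hm a ha
      simp only [List.mem_append, List.mem_cons] at this ⊢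
      tauto)
  rw [pathLength_append_cons] at h
  simpa [pathLength] using h

theorem le_TSP {r : ℝ} {p q : Lamp X}
    (h : ∀ l : List X, l.head? = some p.2 → l.getLast? = some q.2 → (∀ a ∈ sd p q, a ∈ l) →
      r ≤ pathLength d l) : r ≤ TSP d p q := by
  refine le_csInf ⟨_, p.2 :: ((symmDiff p.1 q.1).toList ++ [q.2]), by simp, ?_, ?_, rfl⟩ ?_
  · rw [← List.cons_append, List.getLast?_append]
    simp
  · intro a ha
    rw [sd_eq_coe_symmDiff, Finset.mem_coe] at ha
    simp [ha]
  · rintro _ ⟨l, h1, h2, h3, rfl⟩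
    exact h l h1 h2 h3

theorem TSCP_le {r : ℝ} (hr : 0 ≤ r) {p q : Lamp X}
    (h : ∀ u ∈ ({p.2, q.2} ∪ sd p q : Set X), ∀ v ∈ ({p.2, q.2} ∪ sd p q : Set X), d u v ≤ r) :
    TSCP d p q ≤ r :=
  ENNReal.toReal_le_of_le_ofReal hr <| iSup₂_le fun u hu => iSup₂_le fun v hv =>
    ENNReal.ofReal_le_ofReal (h u hu v hv)

theorem dist_le_TSCP {R : ℝ} (hR : ∀ u v : X, d u v ≤ R) {p q : Lamp X} {u v : X}
    (hu : u ∈ ({p.2, q.2} ∪ sd p q : Set X)) (hv : v ∈ ({p.2, q.2} ∪ sd p q : Set X)) :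
    d u v ≤ TSCP d p q := by
  have hfin : ediamD d ({p.2, q.2} ∪ sd p q) ≠ ⊤ :=
    ne_top_of_le_ne_top ENNReal.ofReal_ne_top (b := ENNReal.ofReal R) <|
      iSup₂_le fun a _ => iSup₂_le fun b _ => ENNReal.ofReal_le_ofReal (hR a b)
  refine (ENNReal.ofReal_le_iff_le_toReal hfin).1 ?_
  exact le_iSup₂_of_le u hu (le_iSup₂_of_le v hv le_rfl)

theorem TSCP_nonneg (p q : Lamp X) : 0 ≤ TSCP d p q := ENNReal.toReal_nonneg

theorem TSCP_le_TSP (h0 : ∀ a b, 0 ≤ d a b) (hself : ∀ a, d a a = 0)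
    (hcomm : ∀ a b, d a b = d b a) (htri : ∀ a b c, d a c ≤ d a b + d b c) (p q : Lamp X) :
    TSCP d p q ≤ TSP d p q := by
  refine le_TSP fun l hh hl hm => TSCP_le (pathLength_nonneg h0 l) ?_
  have : ∀ u ∈ ({p.2, q.2} ∪ sd p q : Set X), u ∈ l := by
    rintro u ((rfl | rfl) | hu)
    · exact List.mem_of_mem_head? hh
    · exact List.mem_of_mem_getLast? hl
    · exact hm u hu
  exact fun u hu v hv => dist_le_pathLength h0 hself hcomm htri l (this u hu) (this v hv)

end Tours

section LampEmbedding

/-- The point of the lamp tree of `f` given by a configuration and the height of the position. -/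
def lampHeightOf (f : X → ℝ≥0) (p : Lamp X) : LampHeight f := ⟨p.1, f p.2⟩

theorem le_merge_lampHeightOf (f : X → ℝ≥0) {p q : Lamp X} {u : X}
    (hu : u ∈ ({p.2, q.2} ∪ sd p q : Set X)) :
    f u ≤ (lampHeightOf f p).merge (lampHeightOf f q) := by
  rcases hu with (rfl | rfl) | hu
  · exact (le_max_left _ _).trans (le_max_left _ _)
  · exact (le_max_right _ _).trans (le_max_left _ _)
  · rw [sd_eq_coe_symmDiff, Finset.mem_coe] at hu
    exact (Finset.le_sup (f := f) hu).trans (le_max_right _ _)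

theorem exists_merge_lampHeightOf_eq (f : X → ℝ≥0) (p q : Lamp X) :
    ∃ u ∈ ({p.2, q.2} ∪ sd p q : Set X), (lampHeightOf f p).merge (lampHeightOf f q) = f u := by
  have hmax : ∃ u ∈ ({p.2, q.2} ∪ sd p q : Set X), max (f p.2) (f q.2) = f u := by
    rcases max_choice (f p.2) (f q.2) with h | h
    · exact ⟨p.2, by simp, h⟩
    · exact ⟨q.2, by simp, h⟩
  rcases max_choice (max (f p.2) (f q.2)) ((symmDiff p.1 q.1).sup f) with h | h
  · obtain ⟨u, hu, he⟩ := hmax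
    exact ⟨u, hu, h.trans he⟩
  · rcases (symmDiff p.1 q.1).eq_empty_or_nonempty with h0 | h0
    · obtain ⟨u, hu, he⟩ := hmax
      refine ⟨u, hu, Eq.trans ?_ he⟩
      simp [LampHeight.merge, lampHeightOf, h0]
    · obtain ⟨u, hu, he⟩ := Finset.exists_mem_eq_sup _ h0 f
      refine ⟨u, Or.inr ?_, h.trans he⟩
      rwa [sd_eq_coe_symmDiff, Finset.mem_coe]

theorem dist_const_one_eq (p q : Lamp X) :
    dist (⟨p.1, 0⟩ : LampHeight fun _ : X => 1) ⟨q.1, 0⟩ = 2 * rho p q := by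
  rw [LampHeight.dist_mk, rho]
  split_ifs with h
  · simp [h]
  · have hne : (symmDiff p.1 q.1).Nonempty := by
      rw [Finset.nonempty_iff_ne_empty, ← Finset.bot_eq_empty, Ne, symmDiff_eq_bot]
      exact h
    rw [Finset.sup_const hne]
    simp

/-- Two lamp trees, one for a height `f` and one for the reversed height `g = N - f`, together
measure the spread of `f` on the positions and the lamps to be switched. -/
theorem dist_add_dist_eq {f g : X → ℝ≥0} {N : ℝ} (hfg : ∀ x, (f x : ℝ) + g x = N)
    (p q : Lamp X) :
    (∃ u ∈ ({p.2, q.2} ∪ sd p q : Set X), ∃ v ∈ ({p.2, q.2} ∪ sd p q : Set X),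
      dist (lampHeightOf f p) (lampHeightOf f q) + dist (lampHeightOf g p) (lampHeightOf g q) =
        2 * ((f u : ℝ) - f v)) ∧
    ∀ u ∈ ({p.2, q.2} ∪ sd p q : Set X), ∀ v ∈ ({p.2, q.2} ∪ sd p q : Set X),
      2 * ((f u : ℝ) - f v) ≤ dist (lampHeightOf f p) (lampHeightOf f q) +
        dist (lampHeightOf g p) (lampHeightOf g q) := by
  have hp := hfg p.2
  have hq := hfg q.2
  have hd : dist (lampHeightOf f p) (lampHeightOf f q) +
      dist (lampHeightOf g p) (lampHeightOf g q) =
      2 * (((lampHeightOf f p).merge (lampHeightOf f q) : ℝ) +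
        (lampHeightOf g p).merge (lampHeightOf g q) - N) := by
    simp only [LampHeight.dist_def]
    have e : ∀ (f : X → ℝ≥0) (p : Lamp X), (lampHeightOf f p).height = f p.2 := fun _ _ => rfl
    rw [e, e, e, e]
    linarith
  rw [hd]
  constructor
  · obtain ⟨u, hu, hfu⟩ := exists_merge_lampHeightOf_eq f p q
    obtain ⟨v, hv, hgv⟩ := exists_merge_lampHeightOf_eq g p q
    refine ⟨u, hu, v, hv, ?_⟩
    rw [hfu, hgv]
    linarith [hfg v]
  · intro u hu v hv
    have h1 : (f u : ℝ) ≤ (lampHeightOf f p).merge (lampHeightOf f q) := by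
      exact_mod_cast le_merge_lampHeightOf f hu
    have h2 : (g v : ℝ) ≤ (lampHeightOf g p).merge (lampHeightOf g q) := by
      exact_mod_cast le_merge_lampHeightOf g hv
    linarith [hfg v]

end LampEmbedding

section Grid

variable {m : ℕ} {n : Fin m → ℕ}

theorem gridMDist_nonneg (x y : GridM m n) : 0 ≤ gridMDist x y :=
  Finset.sum_nonneg fun _ _ => abs_nonneg _

theorem gridMDist_self (x : GridM m n) : gridMDist x x = 0 := by simp [gridMDist]

theorem gridMDist_comm (x y : GridM m n) : gridMDist x y = gridMDist y x :=
  Finset.sum_congr rfl fun _ _ => abs_sub_comm _ _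

theorem gridMDist_triangle (x y z : GridM m n) :
    gridMDist x z ≤ gridMDist x y + gridMDist y z := by
  simp only [gridMDist]
  rw [← Finset.sum_add_distrib]
  exact Finset.sum_le_sum fun _ _ => abs_sub_le _ _ _

theorem abs_sub_le_gridMDist (x y : GridM m n) (i : Fin m) :
    |(x.1 i : ℝ) - y.1 i| ≤ gridMDist x y :=
  Finset.single_le_sum (f := fun i => |(x.1 i : ℝ) - y.1 i|) (fun _ _ => abs_nonneg _)
    (Finset.mem_univ i)

theorem gridMDist_le (x y : GridM m n) : gridMDist x y ≤ ∑ i, (n i : ℝ) := by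
  refine Finset.sum_le_sum fun i _ => ?_
  have hx0 : (0 : ℝ) ≤ x.1 i := by exact_mod_cast (x.2 i).1
  have hx1 : (x.1 i : ℝ) ≤ n i := by exact_mod_cast (x.2 i).2
  have hy0 : (0 : ℝ) ≤ y.1 i := by exact_mod_cast (y.2 i).1
  have hy1 : (y.1 i : ℝ) ≤ n i := by exact_mod_cast (y.2 i).2
  rw [abs_le]
  constructor <;> linarith

theorem one_le_gridMDist {x y : GridM m n} (h : x ≠ y) : 1 ≤ gridMDist x y := by
  obtain ⟨i, hi⟩ : ∃ i, x.1 i ≠ y.1 i := by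
    by_contra! hall
    exact h (Subtype.ext (funext hall))
  refine le_trans ?_ (abs_sub_le_gridMDist x y i)
  have : (1 : ℤ) ≤ |x.1 i - y.1 i| := Int.one_le_abs (sub_ne_zero.2 hi)
  exact_mod_cast this

/-- A point of the grid different from `x` has a neighbour closer to `x`, which lies in every
box containing both points. -/
theorem exists_closer_neighbour {x v : GridM m n} (h : v ≠ x) :
    ∃ s : GridM m n, gridMDist s v ≤ 1 ∧
      ∑ i, (s.1 i - x.1 i).natAbs < ∑ i, (v.1 i - x.1 i).natAbs ∧
      ∀ i, min (x.1 i) (v.1 i) ≤ s.1 i ∧ s.1 i ≤ max (x.1 i) (v.1 i) := by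
  obtain ⟨i, hi⟩ : ∃ i, v.1 i ≠ x.1 i := by
    by_contra! hall
    exact h (Subtype.ext (funext hall))
  obtain ⟨e, he, hlt, hmin, hmax⟩ : ∃ e : ℤ, |e - v.1 i| ≤ 1 ∧
      (e - x.1 i).natAbs < (v.1 i - x.1 i).natAbs ∧
      min (x.1 i) (v.1 i) ≤ e ∧ e ≤ max (x.1 i) (v.1 i) := by
    rcases lt_or_gt_of_ne hi with hi | hi
    · exact ⟨v.1 i + 1, by simp, by omega, by omega, by omega⟩
    · exact ⟨v.1 i - 1, by simp, by omega, by omega, by omega⟩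
  have hb : ∀ j, min (x.1 j) (v.1 j) ≤ Function.update v.1 i e j ∧
      Function.update v.1 i e j ≤ max (x.1 j) (v.1 j) := by
    intro j
    rcases eq_or_ne j i with rfl | hj
    · rw [Function.update_self]
      exact ⟨hmin, hmax⟩
    · simp [Function.update_of_ne hj]
  refine ⟨⟨Function.update v.1 i e, fun j => ?_⟩, ?_, ?_, hb⟩
  · have h1 := hb j
    have h2 := x.2 j
    have h3 := v.2 j
    omega
  · unfold gridMDist
    rw [Finset.sum_eq_single i]
    · simp only [Function.update_self]
      exact_mod_cast he
    · intro j _ hj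
      simp [Function.update_of_ne hj]
    · simp
  · refine Finset.sum_lt_sum (fun j _ => ?_) ⟨i, Finset.mem_univ i, by simpa using hlt⟩
    rcases eq_or_ne j i with rfl | hj
    · simpa using hlt.le
    · simp [Function.update_of_ne hj]

/-- A box in the grid has a closed tour of length at most twice its number of points. -/
theorem exists_tour_box (x : GridM m n) (lo hi : Fin m → ℤ)
    (hx : ∀ i, lo i ≤ x.1 i ∧ x.1 i ≤ hi i) :
    ∃ l : List (GridM m n), l.head? = some x ∧ l.getLast? = some x ∧
      (∀ v : GridM m n, (∀ i, lo i ≤ v.1 i ∧ v.1 i ≤ hi i) → v ∈ l) ∧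
      pathLength gridMDist l ≤ 2 * ∏ i, ((Finset.Icc (lo i) (hi i)).card : ℝ) := by
  set B : Finset (GridM m n) :=
    (Fintype.piFinset fun i => Finset.Icc (lo i) (hi i)).subtype
      (fun p => ∀ i, 0 ≤ p i ∧ p i ≤ (n i : ℤ)) with hB
  have hmem : ∀ v : GridM m n, v ∈ B ↔ ∀ i, lo i ≤ v.1 i ∧ v.1 i ≤ hi i := by
    intro v
    rw [hB]
    erw [Finset.mem_subtype]
    simp [Fintype.mem_piFinset]
  have hcard : (B.card : ℝ) ≤ ∏ i, ((Finset.Icc (lo i) (hi i)).card : ℝ) := by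
    have h : B.card ≤ ∏ i, (Finset.Icc (lo i) (hi i)).card := by
      rw [← Fintype.card_piFinset, hB]
      erw [Finset.card_subtype]
      exact Finset.card_filter_le _ _
    exact_mod_cast h
  obtain ⟨l, hh, hl, hcov, hlen⟩ := exists_tour (d := gridMDist) gridMDist_comm x
    (fun v => ∑ i, (v.1 i - x.1 i).natAbs) (B.erase x) (fun v hv => by
      obtain ⟨hvx, hvB⟩ := Finset.mem_erase.1 hv
      obtain ⟨s, h1, h2, h3⟩ := exists_closer_neighbour hvx
      refine ⟨s, ?_, h1, h2⟩
      by_cases hsx : s = x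
      · simp [hsx]
      · refine Finset.mem_insert_of_mem (Finset.mem_erase.2 ⟨hsx, (hmem s).2 fun i => ?_⟩)
        have := h3 i
        have := (hmem v).1 hvB i
        have := hx i
        omega)
  refine ⟨l, hh, hl, fun v hv => hcov v ?_, hlen.trans ?_⟩
  · by_cases hvx : v = x
    · simp [hvx]
    · exact Finset.mem_insert_of_mem (Finset.mem_erase.2 ⟨hvx, (hmem v).2 hv⟩)
  · have : ((B.erase x).card : ℝ) ≤ B.card := by exact_mod_cast Finset.card_erase_le
    linarith

theorem one_le_prod_sides (h1 : ∀ i, 1 ≤ n i) :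
    1 ≤ ∏ i ∈ Finset.univ.filter (fun i : Fin m => (i : ℕ) < m - 1), (n i : ℝ) := by
  exact_mod_cast Nat.succ_le_of_lt (Finset.prod_pos fun i _ => h1 i)

theorem tspEfficient_gridM (hm : 2 ≤ m) (h1 : ∀ i, 1 ≤ n i) :
    TSPEfficient (gridMDist : GridM m n → GridM m n → ℝ) ((6 * 2 ^ m + 1) *
      ∏ i ∈ Finset.univ.filter (fun i : Fin m => (i : ℕ) < m - 1), (n i : ℝ)) := by
  intro p q
  set P := ∏ i ∈ Finset.univ.filter (fun i : Fin m => (i : ℕ) < m - 1), (n i : ℝ) with hP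
  have hP1 : 1 ≤ P := one_le_prod_sides h1
  set D := TSCP gridMDist p q with hDdef
  have hD0 : 0 ≤ D := TSCP_nonneg p q
  have hdist : ∀ u ∈ ({p.2, q.2} ∪ sd p q : Set (GridM m n)),
      ∀ v ∈ ({p.2, q.2} ∪ sd p q : Set (GridM m n)), gridMDist u v ≤ D :=
    fun u hu v hv => dist_le_TSCP gridMDist_le hu hv
  have hpS : p.2 ∈ ({p.2, q.2} ∪ sd p q : Set (GridM m n)) := by simp
  have hqS : q.2 ∈ ({p.2, q.2} ∪ sd p q : Set (GridM m n)) := by simp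
  by_cases hall : ∀ u ∈ ({p.2, q.2} ∪ sd p q : Set (GridM m n)), u = p.2
  · refine (TSP_le_pathLength (l := [p.2]) gridMDist_nonneg (by simp)
      (by simp [hall q.2 hqS]) fun a ha => ?_).trans ?_
    · simp [hall a (Or.inr ha)]
    · simp only [pathLength]
      positivity
  push Not at hall
  obtain ⟨u, hu, hup⟩ := hall
  have hD1 : 1 ≤ D := (one_le_gridMDist hup).trans (hdist u hu _ hpS)
  set k : ℤ := ⌊D⌋ with hk
  have hk0 : 0 ≤ k := Int.floor_nonneg.2 hD0
  set lo : Fin m → ℤ := fun i => if (i : ℕ) < m - 1 then 0 else p.2.1 i - k with hlo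
  set hi : Fin m → ℤ := fun i => if (i : ℕ) < m - 1 then n i else p.2.1 i + k with hhi
  have hbox : ∀ v ∈ ({p.2, q.2} ∪ sd p q : Set (GridM m n)),
      ∀ i, lo i ≤ v.1 i ∧ v.1 i ≤ hi i := by
    intro v hv i
    simp only [hlo, hhi]
    split_ifs with h
    · exact v.2 i
    · have h2 := (abs_sub_le_gridMDist v p.2 i).trans (hdist v hv _ hpS)
      have h3 : |v.1 i - p.2.1 i| ≤ k := Int.le_floor.2 (by exact_mod_cast h2)
      rw [abs_le] at h3
      omega
  obtain ⟨l, hh, hl, hcov, hlen⟩ := exists_tour_box p.2 lo hi (hbox _ hpS)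
  have hT := TSP_le_pathLength_add (p := p) (q := q) gridMDist_nonneg hh hl
    fun a ha => hcov a (hbox a (Or.inr ha))
  have hprod : ∏ i, ((Finset.Icc (lo i) (hi i)).card : ℝ) ≤ 2 ^ m * P * (3 * D) := by
    have hle : ∏ i, ((Finset.Icc (lo i) (hi i)).card : ℝ) ≤
        ∏ i : Fin m, if (i : ℕ) < m - 1 then 2 * (n i : ℝ) else 3 * D := by
      refine Finset.prod_le_prod (fun _ _ => Nat.cast_nonneg _) fun i _ => ?_
      simp only [hlo, hhi]
      split_ifs with h
      · have : (1 : ℝ) ≤ n i := by exact_mod_cast h1 i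
        simp only [Int.card_Icc]
        have e : ((n i : ℤ) + 1 - 0).toNat = n i + 1 := by omega
        rw [e]
        push_cast
        linarith
      · simp only [Int.card_Icc]
        have e : (((p.2.1 i + k + 1 - (p.2.1 i - k)).toNat : ℤ) : ℝ) = 2 * k + 1 := by
          rw [Int.toNat_of_nonneg (by omega)]
          push_cast
          ring
        have hkD : (k : ℝ) ≤ D := Int.floor_le D
        push_cast at e
        rw [e]
        linarith
    refine hle.trans ?_
    rw [Finset.prod_ite, Finset.prod_mul_distrib, Finset.prod_const, Finset.prod_const]
    have hlast : (Finset.univ.filter fun i : Fin m => ¬ (i : ℕ) < m - 1).card = 1 := by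
      rw [Finset.card_eq_one]
      refine ⟨⟨m - 1, by omega⟩, ?_⟩
      ext i
      simp only [Finset.mem_filter, Finset.mem_univ, true_and, Finset.mem_singleton, Fin.ext_iff]
      omega
    rw [hlast, pow_one, ← hP]
    have hpow : (2 : ℝ) ^ (Finset.univ.filter fun i : Fin m => (i : ℕ) < m - 1).card ≤ 2 ^ m := by
      refine pow_le_pow_right₀ (by norm_num) ?_
      simpa using Finset.card_filter_le (Finset.univ : Finset (Fin m)) fun i => (i : ℕ) < m - 1
    gcongr
  have hpq := hdist _ hpS _ hqS
  have hDP : D ≤ P * D := le_mul_of_one_le_left hD0 hP1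
  calc TSP gridMDist p q ≤ 2 * (2 ^ m * P * (3 * D)) + P * D := by linarith
    _ = (6 * 2 ^ m + 1) * P * D := by ring

/-- The height functions of the trees: a coordinate, the reversed coordinate, and a constant. -/
def gridHeight (n : Fin m → ℕ) (k : Fin 3) (i : Fin m) (v : GridM m n) : ℝ≥0 :=
  ![(v.1 i : ℝ).toNNReal, ((n i : ℝ) - v.1 i).toNNReal, 1] k

/-- The lamplighter space of the grid, mapped to one of the trees. -/
def gridTreeMap (n : Fin m → ℕ) (k : Fin 3) (i : Fin m) (p : Lamp (GridM m n)) :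
    LampTree (gridHeight n k i) :=
  SeparationQuotient.mk ⟨p.1, if k = 2 then 0 else gridHeight n k i p.2⟩

theorem dist_gridTreeMap_two (i : Fin m) (p q : Lamp (GridM m n)) :
    dist (gridTreeMap n 2 i p) (gridTreeMap n 2 i q) = 2 * rho p q := by
  rw [gridTreeMap, gridTreeMap, SeparationQuotient.dist_mk, if_pos rfl, if_pos rfl]
  exact dist_const_one_eq p q

theorem dist_gridTreeMap_add (i : Fin m) (p q : Lamp (GridM m n)) :
    (∃ u ∈ ({p.2, q.2} ∪ sd p q : Set (GridM m n)),
      ∃ v ∈ ({p.2, q.2} ∪ sd p q : Set (GridM m n)),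
      dist (gridTreeMap n 0 i p) (gridTreeMap n 0 i q) +
        dist (gridTreeMap n 1 i p) (gridTreeMap n 1 i q) = 2 * ((u.1 i : ℝ) - v.1 i)) ∧
    ∀ u ∈ ({p.2, q.2} ∪ sd p q : Set (GridM m n)),
      ∀ v ∈ ({p.2, q.2} ∪ sd p q : Set (GridM m n)),
      2 * |(u.1 i : ℝ) - v.1 i| ≤ dist (gridTreeMap n 0 i p) (gridTreeMap n 0 i q) +
        dist (gridTreeMap n 1 i p) (gridTreeMap n 1 i q) := by
  have e0 : ∀ v : GridM m n, (gridHeight n 0 i v : ℝ) = v.1 i := fun v =>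
    Real.coe_toNNReal _ (by exact_mod_cast (v.2 i).1)
  have e1 : ∀ v : GridM m n, (gridHeight n 1 i v : ℝ) = n i - v.1 i := fun v =>
    Real.coe_toNNReal _ (sub_nonneg.2 (by exact_mod_cast (v.2 i).2))
  obtain ⟨⟨u, hu, v, hv, huv⟩, h⟩ := dist_add_dist_eq (f := gridHeight n 0 i)
    (g := gridHeight n 1 i) (N := n i) (fun x => by rw [e0, e1]; ring) p q
  simp only [e0] at huv h
  refine ⟨⟨u, hu, v, hv, huv⟩, fun u hu v hv => ?_⟩
  rcases abs_choice ((u.1 i : ℝ) - v.1 i) with ha | ha <;> rw [ha]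
  · exact h u hu v hv
  · rw [neg_sub]
    exact h v hv u hu

/-- The sum of the distances in all the trees. -/
theorem sum_dist_gridTreeMap_bounds (p q : Lamp (GridM m n)) :
    2 * TSCP gridMDist p q + 2 * m * rho p q ≤
        ∑ i, ∑ k, dist (gridTreeMap n k i p) (gridTreeMap n k i q) ∧
      ∑ i, ∑ k, dist (gridTreeMap n k i p) (gridTreeMap n k i q) ≤
        2 * m * TSCP gridMDist p q + 2 * m * rho p q := by
  have hsum : ∑ i, ∑ k, dist (gridTreeMap n k i p) (gridTreeMap n k i q) =
      ∑ i, (dist (gridTreeMap n 0 i p) (gridTreeMap n 0 i q) +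
        dist (gridTreeMap n 1 i p) (gridTreeMap n 1 i q)) + 2 * m * rho p q := by
    simp only [Fin.sum_univ_three, dist_gridTreeMap_two, Finset.sum_add_distrib,
      Finset.sum_const, Finset.card_univ, Fintype.card_fin, nsmul_eq_mul]
    ring
  rw [hsum]
  constructor
  · refine add_le_add ?_ le_rfl
    have h0 : 0 ≤ ∑ i, (dist (gridTreeMap n 0 i p) (gridTreeMap n 0 i q) +
        dist (gridTreeMap n 1 i p) (gridTreeMap n 1 i q)) :=
      Finset.sum_nonneg fun i _ => add_nonneg dist_nonneg dist_nonneg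
    have := TSCP_le (d := gridMDist) (p := p) (q := q) (div_nonneg h0 zero_le_two) fun u hu v hv => by
      rw [le_div_iff₀ (by norm_num), mul_comm, gridMDist, Finset.mul_sum]
      exact Finset.sum_le_sum fun i _ => (dist_gridTreeMap_add i p q).2 u hu v hv
    linarith
  · refine add_le_add ?_ le_rfl
    calc _ ≤ ∑ _i : Fin m, 2 * TSCP gridMDist p q := by
          refine Finset.sum_le_sum fun i _ => ?_
          obtain ⟨u, hu, v, hv, huv⟩ := (dist_gridTreeMap_add i p q).1
          rw [huv]
          have := dist_le_TSCP (p := p) (q := q) gridMDist_le hu hv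
          linarith [le_abs_self ((u.1 i : ℝ) - v.1 i), abs_sub_le_gridMDist u v i]
      _ = 2 * m * TSCP gridMDist p q := by
          simp
          ring

end Grid

/-- For every `m ≥ 2` there is a constant `c_m` such that for all
`1 ≤ n_1 ≤ … ≤ n_m`, the lamplighter space over the `m`-dimensional grid
`G^m({n_i})` (with the ℓ1 metric) admits a `C`-biLipschitz embedding into an
ℓ1-product of `3m` ℝ-trees with `C ≤ m · c_m · ∏_{i=1}^{m-1} n_i`; in particular
`G^m({n_i})` is `K`-TSP-efficient with `K ≤ c_m · ∏_{i=1}^{m-1} n_i`, a bound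
independent of the largest dimension `n_m`. -/
theorem statement18 (m : ℕ) (hm : 2 ≤ m) :
    ∃ c : ℝ, 0 < c ∧
      ∀ n : Fin m → ℕ, (∀ i, 1 ≤ n i) → (∀ i j : Fin m, i ≤ j → n i ≤ n j) →
        (∃ (T : Fin (3 * m) → Type) (I : ∀ i, MetricSpace (T i)),
          (∀ i, @IsRTree (T i) (I i)) ∧
          ∃ f : Lamp (GridM m n) → ∀ i, T i,
            BiLipWith (dLa (gridMDist : GridM m n → GridM m n → ℝ)) (piL1Dist I)
              ((m : ℝ) * c *
                ∏ i ∈ Finset.univ.filter (fun i : Fin m => (i : ℕ) < m - 1), (n i : ℝ)) f) ∧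
        TSPEfficient (gridMDist : GridM m n → GridM m n → ℝ)
          (c * ∏ i ∈ Finset.univ.filter (fun i : Fin m => (i : ℕ) < m - 1), (n i : ℝ)) := by
  refine ⟨6 * 2 ^ m + 1, by positivity, fun n h1 _ => ?_⟩
  have heff := tspEfficient_gridM hm h1
  refine ⟨?_, heff⟩
  set P := ∏ i ∈ Finset.univ.filter (fun i : Fin m => (i : ℕ) < m - 1), (n i : ℝ) with hP
  have hP1 : 1 ≤ P := one_le_prod_sides h1
  set K : ℝ := (6 * 2 ^ m + 1) * P with hK
  have hK1 : 1 ≤ K := by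
    have : (1 : ℝ) ≤ 6 * 2 ^ m + 1 := le_add_of_nonneg_left (by positivity)
    exact one_le_mul_of_one_le_of_one_le this hP1
  have hK0 : 0 < K := zero_lt_one.trans_le hK1
  have hm1 : (1 : ℝ) ≤ m := by exact_mod_cast (by omega : 1 ≤ m)
  let e : Fin (3 * m) ≃ Fin 3 × Fin m := finProdFinEquiv.symm
  refine ⟨fun j => LampTree (gridHeight n (e j).1 (e j).2), fun j => inferInstance,
    fun j => LampTree.isRTree, fun p j => gridTreeMap n (e j).1 (e j).2 p, ?_⟩
  have hbounds : ∀ p q : Lamp (GridM m n),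
      2 / K * dLa gridMDist p q ≤
        ∑ j, dist (gridTreeMap n (e j).1 (e j).2 p) (gridTreeMap n (e j).1 (e j).2 q) ∧
      ∑ j, dist (gridTreeMap n (e j).1 (e j).2 p) (gridTreeMap n (e j).1 (e j).2 q) ≤
        m * (6 * 2 ^ m + 1) * P * (2 / K) * dLa gridMDist p q := by
    intro p q
    have hsum : ∑ j, dist (gridTreeMap n (e j).1 (e j).2 p) (gridTreeMap n (e j).1 (e j).2 q) =
        ∑ i, ∑ k, dist (gridTreeMap n k i p) (gridTreeMap n k i q) := by
      rw [e.sum_comp fun x : Fin 3 × Fin m =>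
        dist (gridTreeMap n x.1 x.2 p) (gridTreeMap n x.1 x.2 q), Fintype.sum_prod_type_right]
    rw [hsum]
    obtain ⟨hlow, hup⟩ := sum_dist_gridTreeMap_bounds p q
    have hrho : 0 ≤ rho p q := by
      rw [rho]
      split_ifs <;> norm_num
    have hle := TSCP_le_TSP gridMDist_nonneg gridMDist_self gridMDist_comm gridMDist_triangle p q
    constructor
    · refine le_trans ?_ hlow
      rw [dLa, div_mul_eq_mul_div, div_le_iff₀ hK0]
      have h2 : rho p q ≤ m * rho p q * K :=
        (le_mul_of_one_le_left hrho hm1).trans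
          (le_mul_of_one_le_right (by positivity) hK1)
      have h3 := heff p q
      nlinarith
    · refine hup.trans ?_
      have h2 : m * (6 * 2 ^ m + 1) * P * (2 / K) = 2 * (m : ℝ) := by
        rw [mul_assoc (m : ℝ), ← hK]
        field_simp
      rw [h2, dLa, mul_add]
      gcongr
  refine ⟨fun p q hpq => ?_, 2 / K, by positivity, hbounds⟩
  have h := (hbounds p q).1
  have hz : ∑ j, dist (gridTreeMap n (e j).1 (e j).2 p) (gridTreeMap n (e j).1 (e j).2 q) = 0 :=
    Finset.sum_eq_zero fun j _ => dist_eq_zero.2 (congrFun hpq j)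
  rw [hz] at h
  have hd : dLa gridMDist p q ≤ 0 := by
    by_contra! hpos
    exact absurd h (not_le.2 (by positivity))
  have hle := TSCP_le_TSP gridMDist_nonneg gridMDist_self gridMDist_comm gridMDist_triangle p q
  have hTSCP : 0 ≤ TSCP gridMDist p q := TSCP_nonneg p q
  rw [dLa, rho] at hd
  have h1 : p.1 = q.1 := by
    by_contra hne
    rw [if_neg hne] at hd
    linarith
  have h2 : p.2 = q.2 := by
    by_contra hne
    have := (one_le_gridMDist hne).trans
      (dist_le_TSCP (p := p) (q := q) gridMDist_le (by simp) (by simp))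
    rw [if_pos h1] at hd
    linarith
  exact Prod.ext h1 h2

end Lamplighter
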